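/- Let G be a finite additive abelian group, d : G → ℤ any function, set ε₀ := |{x : d x ≠ 0}| / |G|, and let 0 < α < 1 and β > 0 be real numbers. Then at least one of the following holds: (i) |{x : d x + d (−x) ≠ 0}| ≥ 2β·|G|, or (ii) |{(x, y) ∈ G × G : d y + d (x − y) ≠ d x}| ≥ (1 − α)·(ε₀/2 − β − (1/α)·(ε₀/2)²)·|G|². In particular the bound is independent of the size of G. -/

import Mathlib

open Finset

section AdditivityDefect

lemma card_filter_sub_snd {G : Type*} [AddCommGroup G] [Fintype G] (Q : G → G → Prop)
    [DecidableRel Q] :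
    #{p : G × G | Q p.1 (p.1 - p.2)} = #{p : G × G | Q p.1 p.2} :=
  card_bij' (fun p _ => (p.1, p.1 - p.2)) (fun p _ => (p.1, p.1 - p.2))
    (by simp) (by simp) (by simp) (by simp)

lemma card_filter_fst_and_snd {G : Type*} [Fintype G] (A B : G → Prop) [DecidablePred A]
    [DecidablePred B] :
    #{p : G × G | A p.1 ∧ B p.2} = #{x | A x} * #{x | B x} := by
  rw [← card_product, ← filter_product, univ_product_univ]

lemma card_pos_add_card_neg {G : Type*} [Fintype G] [DecidableEq G] (d : G → ℤ) :
    #{x | 0 < d x} + #{x | d x < 0} = #{x | d x ≠ 0} := by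
  rw [← card_union_of_disjoint]
  · congr 1
    ext x
    simp only [mem_filter_univ, mem_union]
    omega
  · rw [disjoint_filter]
    intros
    omega

lemma card_filter_pos_lt_swap {G : Type*} [Fintype G] (d : G → ℤ) :
    #{p : G × G | 0 < d p.2 ∧ d p.2 < d p.1} = #{p : G × G | 0 < d p.1 ∧ d p.1 < d p.2} :=
  card_bij' (fun p _ => p.swap) (fun p _ => p.swap) (by simp) (by simp) (by simp) (by simp)

lemma two_mul_card_pos_lt_le {G : Type*} [Fintype G] [DecidableEq G] (d : G → ℤ) :
    2 * #{p : G × G | 0 < d p.1 ∧ d p.1 < d p.2} ≤ #{x | 0 < d x} * #{x | 0 < d x} := by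
  have hdisj : Disjoint ({p : G × G | 0 < d p.1 ∧ d p.1 < d p.2} : Finset (G × G))
      ({p : G × G | 0 < d p.2 ∧ d p.2 < d p.1} : Finset (G × G)) := by
    rw [disjoint_filter]
    intros
    omega
  rw [← card_filter_fst_and_snd (fun x => 0 < d x) (fun x => 0 < d x), two_mul]
  nth_rewrite 2 [← card_filter_pos_lt_swap d]
  rw [← card_union_of_disjoint hdisj]
  apply card_le_card
  intro p
  simp only [mem_filter_univ, mem_union]
  omega

lemma one_sub_mul_sub_sq_div_le {p α F : ℝ} (hp : 0 ≤ p) (hα : 0 < α) (hα1 : α < 1)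
    (h₁ : p * (1 - 2 * p) ≤ F) (h₂ : p * (5 / 2 * p - 1) ≤ F) :
    (1 - α) * (p - 1 / α * p ^ 2) ≤ F := by
  have e : (1 - α) * (p - 1 / α * p ^ 2) = p * ((1 - α) * (1 - p / α)) := by
    field_simp
  rw [e]
  rcases le_total p (4 / 9) with h | h
  · refine le_trans (mul_le_mul_of_nonneg_left ?_ hp) h₁
    have e₁ : 1 - 2 * p - (1 - α) * (1 - p / α) = (α ^ 2 - 3 * p * α + p) / α := by
      field_simp
      ring
    have : 0 ≤ (α ^ 2 - 3 * p * α + p) / α := by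
      apply div_nonneg _ hα.le
      nlinarith [sq_nonneg (α - 3 / 2 * p), mul_nonneg hp (sub_nonneg.2 h)]
    linarith
  · refine le_trans (mul_le_mul_of_nonneg_left ?_ hp) h₂
    have e₁ : 1 / 9 - (1 - α) * (1 - p / α) =
        ((α - 2 / 3) ^ 2 + (1 - α) * (p - 4 / 9)) / α := by
      field_simp
      ring
    have : 0 ≤ ((α - 2 / 3) ^ 2 + (1 - α) * (p - 4 / 9)) / α := by
      have := mul_nonneg (sub_nonneg.2 hα1.le) (sub_nonneg.2 h)
      positivity
    linarith

variable {G : Type*} [AddCommGroup G] [Fintype G] [DecidableEq G] (d : G → ℤ)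

/-- If `d x > 0` and `d y + d (x - y) = d x`, then `y` or `x - y` is positive. -/
lemma card_pos_mul_card_le :
    #{x | 0 < d x} * Fintype.card G ≤
      #{p : G × G | d p.2 + d (p.1 - p.2) ≠ d p.1} + 2 * (#{x | 0 < d x} * #{x | 0 < d x}) := by
  have hsub : ({p : G × G | 0 < d p.1 ∧ True} : Finset (G × G)) ⊆
      (({p : G × G | d p.2 + d (p.1 - p.2) ≠ d p.1} : Finset (G × G)) ∪
        ({p : G × G | 0 < d p.1 ∧ 0 < d p.2} : Finset (G × G))) ∪
        ({p : G × G | 0 < d p.1 ∧ 0 < d (p.1 - p.2)} : Finset (G × G)) := by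
    intro p
    simp only [mem_filter_univ, mem_union]
    omega
  have h := (card_le_card hsub).trans
    ((card_union_le _ _).trans (Nat.add_le_add_right (card_union_le _ _) _))
  rw [card_filter_sub_snd (fun a b => 0 < d a ∧ 0 < d b),
    card_filter_fst_and_snd (fun x => 0 < d x) (fun _ => True),
    card_filter_fst_and_snd (fun x => 0 < d x) (fun x => 0 < d x)] at h
  simp only [filter_true, card_univ] at h
  omega

/-- If `d x > 0` and `d y + d (x - y) = d x`, then one of `y`, `x - y` has a larger value than `x`,
or one of them has value zero, or `0 < d y < d x`. -/
lemma two_mul_card_pos_mul_card_le :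
    2 * (#{x | 0 < d x} * Fintype.card G) ≤
      2 * #{p : G × G | d p.2 + d (p.1 - p.2) ≠ d p.1} + 3 * (#{x | 0 < d x} * #{x | 0 < d x}) +
        4 * (#{x | 0 < d x} * #{x | d x = 0}) := by
  have hsub : ({p : G × G | 0 < d p.1 ∧ True} : Finset (G × G)) ⊆
      (((((({p : G × G | d p.2 + d (p.1 - p.2) ≠ d p.1} : Finset (G × G)) ∪
        ({p : G × G | 0 < d p.1 ∧ d p.1 < d p.2} : Finset (G × G))) ∪
        ({p : G × G | 0 < d p.1 ∧ d p.1 < d (p.1 - p.2)} : Finset (G × G))) ∪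
        ({p : G × G | 0 < d p.2 ∧ d p.2 < d p.1} : Finset (G × G))) ∪
        ({p : G × G | 0 < d p.1 ∧ d p.2 = 0} : Finset (G × G))) ∪
        ({p : G × G | 0 < d p.1 ∧ d (p.1 - p.2) = 0} : Finset (G × G))) := by
    intro p
    simp only [mem_filter_univ, mem_union]
    omega
  have h := card_le_card hsub
  have hlt := two_mul_card_pos_lt_le d
  grw [card_union_le, card_union_le, card_union_le, card_union_le, card_union_le] at h
  rw [card_filter_sub_snd (fun a b => 0 < d a ∧ d a < d b),
    card_filter_sub_snd (fun a b => 0 < d a ∧ d b = 0), card_filter_pos_lt_swap,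
    card_filter_fst_and_snd (fun x => 0 < d x) (fun _ => True),
    card_filter_fst_and_snd (fun x => 0 < d x) (fun x => d x = 0)] at h
  simp only [filter_true, card_univ] at h
  omega

lemma card_neg_le_card_pos_add :
    #{x | d x < 0} ≤ #{x | 0 < d x} + #{x | d x + d (-x) ≠ 0} := by
  have hneg : #{x | 0 < d (-x)} = #{x | 0 < d x} :=
    card_bij' (fun x _ => -x) (fun x _ => -x) (by simp) (by simp) (by simp) (by simp)
  rw [← hneg]
  refine (card_le_card ?_).trans (card_union_le _ _)
  intro x
  simp only [mem_filter_univ, mem_union]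
  omega

lemma le_card_additivity_defect_of_card_pos_le_card_neg {α β : ℝ} (hα : 0 < α) (hα1 : α < 1)
    (hle : #{x | 0 < d x} ≤ #{x | d x < 0})
    (hbad : (#{x | d x + d (-x) ≠ 0} : ℝ) < 2 * β * Fintype.card G) :
    (1 - α) * ((#{x | d x ≠ 0} : ℝ) / Fintype.card G / 2 - β -
        (1 / α) * ((#{x | d x ≠ 0} : ℝ) / Fintype.card G / 2) ^ 2) * (Fintype.card G : ℝ) ^ 2 ≤
      #{p : G × G | d p.2 + d (p.1 - p.2) ≠ d p.1} := by
  have hN : (0 : ℝ) < Fintype.card G := by exact_mod_cast Fintype.card_pos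
  have h₁ := card_pos_mul_card_le d
  have h₂ := two_mul_card_pos_mul_card_le d
  have hs := card_pos_add_card_neg d
  have hb := card_neg_le_card_pos_add d
  have hz : #{x | d x = 0} + #{x | d x ≠ 0} = Fintype.card G :=
    card_filter_add_card_filter_not (s := univ) (fun x => d x = 0)
  generalize #{x | 0 < d x} = P at *
  generalize #{x | d x < 0} = M at *
  generalize #{x | d x = 0} = Z at *
  generalize #{x | d x ≠ 0} = S at *
  generalize #{x | d x + d (-x) ≠ 0} = B at *
  generalize #{p : G × G | d p.2 + d (p.1 - p.2) ≠ d p.1} = F at *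
  generalize Fintype.card G = N at *
  rify at h₁ h₂ hs hb hz hle
  have hP : (P : ℝ) = P / N * N := by field_simp
  have hS : (S : ℝ) = S / N * N := by field_simp
  have hF : (F : ℝ) = F / N ^ 2 * N ^ 2 := by field_simp
  have hp : 0 ≤ (P / N : ℝ) := by positivity
  set p : ℝ := P / N
  set s : ℝ := S / N
  set f : ℝ := F / N ^ 2
  have hps : p ≤ s / 2 := by
    refine le_of_mul_le_mul_right ?_ hN
    linarith
  have hsβ : s / 2 - β ≤ p := by
    refine le_of_mul_le_mul_right ?_ hN
    linarith
  have hZ : (Z : ℝ) = (1 - s) * N := by linarith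
  rw [hP, hF] at h₁
  rw [hP, hF, hZ] at h₂
  have hf₁ : p * (1 - 2 * p) ≤ f := by
    refine le_of_mul_le_mul_right ?_ (pow_pos hN 2)
    linarith
  have hf₂ : p * (5 / 2 * p - 1) ≤ f := by
    have : p * (2 * s - 1 - 3 / 2 * p) ≤ f := by
      refine le_of_mul_le_mul_right ?_ (pow_pos hN 2)
      linarith
    refine le_trans (mul_le_mul_of_nonneg_left ?_ hp) this
    linarith
  have key := one_sub_mul_sub_sq_div_le hp hα hα1 hf₁ hf₂
  rw [hF]
  refine mul_le_mul_of_nonneg_right (le_trans ?_ key) (by positivity)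
  refine mul_le_mul_of_nonneg_left ?_ (by linarith)
  gcongr

end AdditivityDefect

theorem stmt_13 (G : Type*) [AddCommGroup G] [Fintype G] [DecidableEq G] (d : G → ℤ)
    (ε₀ α β : ℝ)
    (hε₀ : ε₀ = ((Finset.univ.filter fun x : G => d x ≠ 0).card : ℝ) / Fintype.card G)
    (hα : 0 < α) (hα1 : α < 1) (hβ : 0 < β) :
    ((Finset.univ.filter fun x : G => d x + d (-x) ≠ 0).card : ℝ) ≥ 2 * β * Fintype.card G ∨
    ((Finset.univ.filter fun p : G × G => d p.2 + d (p.1 - p.2) ≠ d p.1).card : ℝ) ≥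
      (1 - α) * (ε₀ / 2 - β - (1 / α) * (ε₀ / 2) ^ 2) * (Fintype.card G : ℝ) ^ 2 := by
  rw [or_iff_not_imp_left, not_le]
  intro hbad
  subst hε₀
  rcases le_total #{x | 0 < d x} #{x | d x < 0} with h | h
  · exact le_card_additivity_defect_of_card_pos_le_card_neg d hα hα1 h hbad
  · have h₁ (a b : ℤ) : -a + -b = 0 ↔ a + b = 0 := by omega
    have h₂ (a b c : ℤ) : -a + -b = -c ↔ a + b = c := by omega
    have := le_card_additivity_defect_of_card_pos_le_card_neg (-d) (β := β) hα hα1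
      (by simpa using h) (by simpa [h₁] using hbad)
    simpa only [Pi.neg_apply, ne_eq, neg_eq_zero, h₂] using this
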